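/- (Multilinear Pitt inequality.) Let m,n ≥ 1, let 0 < α_k < n for k = 1,…,m, set α = Σ α_k, assume (m−1)n < α < mn, and set β = α − (m−1)n (so n − β = mn − α and 0 < β < n). Then for every f ∈ 𝒮(ℝ^{mn}), ∫_{ℝ^n} |x|^{−β} |f(x,…,x)|² dx ≤ C_β · Λ(f; α_1,…,α_m), where C_β = π^{−(m−1)n/2 + α} · Π_{k=1}^m [Γ((n−α_k)/2)/Γ(α_k/2)] · [Γ(β/2)/Γ((n−β)/2)] · [Γ((n−β)/4)/Γ((n+β)/4)]². -/

import Mathlib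

open MeasureTheory Real
open scoped ENNReal InnerProductSpace

noncomputable section

/-- Fourier transform with kernel `e^{2πi x·ξ}` on `(ℝ^n)^m`. -/
def fourierM {m n : ℕ} (f : (Fin m → EuclideanSpace ℝ (Fin n)) → ℂ)
    (ξ : Fin m → EuclideanSpace ℝ (Fin n)) : ℂ :=
  ∫ x, Complex.exp (2 * Real.pi * Complex.I * ((∑ k, ⟪x k, ξ k⟫_ℝ : ℝ) : ℂ)) * f x

/-- The multilinear fractional Dirichlet form
`Λ(f; α_1, …, α_m) = ∫ Π_k |ξ_k|^{α_k} |f̂(ξ)|² dξ`. -/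
def LamM {m n : ℕ} (f : (Fin m → EuclideanSpace ℝ (Fin n)) → ℂ)
    (α : Fin m → ℝ) : ℝ≥0∞ :=
  ∫⁻ ξ, (∏ k, ENNReal.ofReal (‖ξ k‖ ^ α k)) * (‖fourierM f ξ‖₊ : ℝ≥0∞) ^ (2 : ℕ)

theorem lintegral_ofReal_of_integral_pos {X : Type*} [MeasurableSpace X] {μ : Measure X}
    {f : X → ℝ} (hf : 0 ≤ᵐ[μ] f) (h : 0 < ∫ x, f x ∂μ) :
    ∫⁻ x, ENNReal.ofReal (f x) ∂μ = ENNReal.ofReal (∫ x, f x ∂μ) :=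
  (ofReal_integral_eq_lintegral_ofReal (Integrable.of_integral_ne_zero h.ne') hf).symm

/-- The density `t ^ (a - 1) / Γ(a)` on the positive half-line, extended by zero. -/
def powDensity (a t : ℝ) : ℝ≥0∞ :=
  (Set.Ioi (0 : ℝ)).indicator (fun t => ENNReal.ofReal (t ^ (a - 1) / Gamma a)) t

theorem powDensity_of_pos (a : ℝ) {t : ℝ} (ht : 0 < t) :
    powDensity a t = ENNReal.ofReal (t ^ (a - 1) / Gamma a) :=
  Set.indicator_of_mem (Set.mem_Ioi.2 ht) _

theorem powDensity_of_nonpos (a : ℝ) {t : ℝ} (ht : t ≤ 0) : powDensity a t = 0 :=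
  Set.indicator_of_notMem (by simpa using ht) _

@[fun_prop]
theorem measurable_powDensity (a : ℝ) : Measurable (powDensity a) :=
  Measurable.indicator (by fun_prop) measurableSet_Ioi

theorem lintegral_powDensity_mul (a : ℝ) (φ : ℝ → ℝ≥0∞) :
    ∫⁻ t, powDensity a t * φ t =
      ∫⁻ t in Set.Ioi 0, ENNReal.ofReal (t ^ (a - 1) / Gamma a) * φ t := by
  rw [← lintegral_indicator measurableSet_Ioi]
  refine lintegral_congr fun t => ?_
  simp only [powDensity, Set.indicator]
  split_ifs <;> simp

theorem powDensity_mul_scale {a b r : ℝ} (ha : 0 < a) (hb : 0 < b) (hr : 0 < r) (x : ℝ) :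
    powDensity a (r * x) * powDensity b (r - r * x) =
      ENNReal.ofReal (r ^ (a + b - 2) / Gamma (a + b)) * ProbabilityTheory.betaPDF a b x := by
  have hΓa := Gamma_pos_of_pos ha
  have hΓb := Gamma_pos_of_pos hb
  have hΓ := Gamma_pos_of_pos (add_pos ha hb)
  rcases le_or_gt x 0 with hx | hx
  · rw [powDensity_of_nonpos a (mul_nonpos_of_nonneg_of_nonpos hr.le hx),
      ProbabilityTheory.betaPDF_eq_zero_of_nonpos hx]
    simp
  rcases le_or_gt 1 x with hx1 | hx1
  · rw [powDensity_of_nonpos b (by nlinarith), ProbabilityTheory.betaPDF_eq_zero_of_one_le hx1]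
    simp
  have h1 : 0 < 1 - x := by linarith
  have hrx : r - r * x = r * (1 - x) := by ring
  rw [hrx, powDensity_of_pos a (by positivity), powDensity_of_pos b (by positivity),
    ProbabilityTheory.betaPDF_of_pos_lt_one hx hx1, ← ENNReal.ofReal_mul (by positivity),
    ← ENNReal.ofReal_mul (by positivity), mul_rpow hr.le hx.le, mul_rpow hr.le h1.le,
    ProbabilityTheory.beta, show a + b - 2 = (a - 1) + (b - 1) by ring, rpow_add hr]
  congr 1
  field_simp

theorem lintegral_eq_mul_lintegral_comp_mul_left {r : ℝ} (hr : 0 < r) {φ : ℝ → ℝ≥0∞}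
    (hφ : Measurable φ) :
    ∫⁻ u, φ u = ENNReal.ofReal r * ∫⁻ x, φ (r * x) := by
  conv_lhs => rw [← Real.smul_map_volume_mul_left hr.ne']
  rw [lintegral_smul_measure, lintegral_map hφ (by fun_prop), abs_of_pos hr, smul_eq_mul]

theorem lintegral_powDensity_mul_powDensity {a b : ℝ} (ha : 0 < a) (hb : 0 < b) (r : ℝ) :
    ∫⁻ u, powDensity a u * powDensity b (r - u) = powDensity (a + b) r := by
  rcases le_or_gt r 0 with hr | hr
  · rw [powDensity_of_nonpos _ hr]
    refine (lintegral_congr fun u => ?_).trans lintegral_zero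
    rcases le_or_gt u 0 with hu | hu
    · simp [powDensity_of_nonpos a hu]
    · simp [powDensity_of_nonpos b (show r - u ≤ 0 by linarith)]
  rw [lintegral_eq_mul_lintegral_comp_mul_left hr (by fun_prop)]
  simp_rw [powDensity_mul_scale ha hb hr]
  rw [lintegral_const_mul' _ _ ENNReal.ofReal_ne_top,
    ProbabilityTheory.lintegral_betaPDF_eq_one ha hb, mul_one, powDensity_of_pos _ hr,
    ← ENNReal.ofReal_mul hr.le]
  congr 1
  rw [show a + b - 1 = (a + b - 2) + 1 by ring, rpow_add_one hr.ne']
  ring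

/-- The densities `powDensity` form a convolution semigroup. -/
theorem lintegral_lintegral_powDensity {a b : ℝ} (ha : 0 < a) (hb : 0 < b) {φ : ℝ → ℝ≥0∞}
    (hφ : Measurable φ) :
    ∫⁻ u, ∫⁻ v, powDensity a u * powDensity b v * φ (u + v) =
      ∫⁻ r, powDensity (a + b) r * φ r := by
  have h (u : ℝ) : ∫⁻ v, powDensity a u * powDensity b v * φ (u + v) =
      ∫⁻ r, powDensity a u * powDensity b (r - u) * φ r := by
    rw [← lintegral_sub_right_eq_self _ u]
    simp
  simp_rw [h]
  rw [lintegral_lintegral_swap (by fun_prop)]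
  refine lintegral_congr fun r => ?_
  rw [lintegral_mul_const _ (by fun_prop), lintegral_powDensity_mul_powDensity ha hb]

theorem ofReal_norm_rpow {E : Type*} [NormedAddCommGroup E] {x : E} (hx : x ≠ 0) (s : ℝ) :
    ENNReal.ofReal (‖x‖ ^ s) = ‖x‖ₑ ^ s := by
  rw [← ofReal_norm, ENNReal.ofReal_rpow_of_pos (norm_pos_iff.2 hx)]

theorem lintegral_powDensity_mul_exp {E : Type*} [NormedAddCommGroup E] {a : ℝ} (ha : 0 < a)
    {x : E} (hx : x ≠ 0) :
    ∫⁻ t, powDensity a t * ENNReal.ofReal (exp (-(π * ‖x‖ ^ 2 * t))) =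
      ENNReal.ofReal (π ^ (-a)) * ‖x‖ₑ ^ (-(2 * a)) := by
  have hx' := norm_pos_iff.2 hx
  have hΓ := Gamma_pos_of_pos ha
  have hr : 0 < π * ‖x‖ ^ 2 := by positivity
  have key : ∫ t in Set.Ioi (0 : ℝ), t ^ (a - 1) / Gamma a * exp (-(π * ‖x‖ ^ 2 * t)) =
      π ^ (-a) * ‖x‖ ^ (-(2 * a)) := by
    have := integral_rpow_mul_exp_neg_mul_Ioi ha hr
    simp_rw [div_mul_eq_mul_div]
    rw [integral_div, this, mul_div_cancel_right₀ _ hΓ.ne', one_div, inv_rpow hr.le,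
      ← rpow_neg hr.le, mul_rpow (by positivity) (by positivity), ← rpow_natCast ‖x‖ 2,
      ← rpow_mul hx'.le]
    congr 2
    push_cast
    ring
  rw [lintegral_powDensity_mul, ← ofReal_norm_rpow hx, ← ENNReal.ofReal_mul (by positivity),
    ← key, ← lintegral_ofReal_of_integral_pos _ (key ▸ by positivity)]
  · refine setLIntegral_congr_fun measurableSet_Ioi fun t ht => ?_
    have : (0 : ℝ) < t := ht
    rw [ENNReal.ofReal_mul (by positivity)]
  · filter_upwards [ae_restrict_mem measurableSet_Ioi] with t ht
    have : (0 : ℝ) < t := ht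
    simp only [Pi.zero_apply]
    positivity

section Riesz

variable {E : Type*} [NormedAddCommGroup E] [InnerProductSpace ℝ E]

open Module (finrank)

/-- The heat kernel `t ^ (-d / 2) exp (-π |x|² / t)`, normalized to have total mass one. -/
def heatKernel (t : ℝ) (x : E) : ℝ≥0∞ :=
  ENNReal.ofReal (t ^ (-(finrank ℝ E / 2 : ℝ)) * exp (-(π * ‖x‖ ^ 2 / t)))

/-- The Riesz kernel of order `a`, as a Gamma-weighted superposition of heat kernels. -/
def rieszKernel (a : ℝ) (x : E) : ℝ≥0∞ := ∫⁻ t, powDensity (a / 2) t * heatKernel t x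

theorem rieszKernel_neg (a : ℝ) (x : E) : rieszKernel a (-x) = rieszKernel a x := by
  simp [rieszKernel, heatKernel]

/-- The constant relating the Riesz kernel of order `a` in dimension `d` to a power of the norm. -/
def rieszConst (d a : ℝ) : ℝ := π ^ (-((d - a) / 2)) * Gamma ((d - a) / 2) / Gamma (a / 2)

theorem rieszConst_pos {d a : ℝ} (ha : 0 < a) (had : a < d) : 0 < rieszConst d a := by
  have := Gamma_pos_of_pos (half_pos ha)
  have := Gamma_pos_of_pos (half_pos (sub_pos.2 had))
  unfold rieszConst
  positivity

theorem rieszKernel_eq {a : ℝ} (ha : 0 < a) (had : a < finrank ℝ E) {x : E} (hx : x ≠ 0) :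
    rieszKernel a x = ENNReal.ofReal (rieszConst (finrank ℝ E) a) *
      ‖x‖ₑ ^ (-(finrank ℝ E - a)) := by
  have hx' := norm_pos_iff.2 hx
  set d : ℝ := (finrank ℝ E : ℝ) with hd
  have hΓ := Gamma_pos_of_pos (half_pos ha)
  have hda : 0 < (d - a) / 2 := half_pos (sub_pos.2 had)
  have hΓ' := Gamma_pos_of_pos hda
  have hr : 0 < π * ‖x‖ ^ 2 := by positivity
  have key : ∫ t in Set.Ioi (0 : ℝ),
      t ^ (a / 2 - 1) / Gamma (a / 2) * (t ^ (-(d / 2)) * exp (-(π * ‖x‖ ^ 2 / t))) =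
      rieszConst d a * ‖x‖ ^ (-(d - a)) := by
    rw [← integral_comp_rpow_Ioi _ (p := -1) (by norm_num)]
    have hint := integral_rpow_mul_exp_neg_mul_Ioi hda hr
    have : ∀ t ∈ Set.Ioi (0 : ℝ), (|(-1 : ℝ)| * t ^ ((-1 : ℝ) - 1)) •
        ((t ^ (-1 : ℝ)) ^ (a / 2 - 1) / Gamma (a / 2) *
          ((t ^ (-1 : ℝ)) ^ (-(d / 2)) * exp (-(π * ‖x‖ ^ 2 / t ^ (-1 : ℝ))))) =
        t ^ ((d - a) / 2 - 1) * exp (-(π * ‖x‖ ^ 2 * t)) / Gamma (a / 2) := by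
      intro t ht
      have ht : (0 : ℝ) < t := ht
      rw [← rpow_mul ht.le, ← rpow_mul ht.le, rpow_neg_one, div_inv_eq_mul, abs_neg, abs_one,
        one_mul, smul_eq_mul,
        show (d - a) / 2 - 1 = (-1 - 1) + (-1 * (a / 2 - 1)) + (-1 * -(d / 2)) by ring,
        rpow_add ht, rpow_add ht]
      ring
    rw [setIntegral_congr_fun measurableSet_Ioi this, integral_div, hint, one_div,
      inv_rpow hr.le, ← rpow_neg hr.le, mul_rpow (by positivity) (by positivity),
      ← rpow_natCast ‖x‖ 2, ← rpow_mul hx'.le, rieszConst,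
      show ((2 : ℕ) : ℝ) * -((d - a) / 2) = -(d - a) by push_cast; ring]
    ring
  have hc := rieszConst_pos ha had
  rw [rieszKernel, lintegral_powDensity_mul, ← ofReal_norm_rpow hx,
    ← ENNReal.ofReal_mul hc.le, ← key,
    ← lintegral_ofReal_of_integral_pos _ (key ▸ by positivity)]
  · refine setLIntegral_congr_fun measurableSet_Ioi fun t ht => ?_
    have : (0 : ℝ) < t := ht
    rw [heatKernel, ← hd, ← ENNReal.ofReal_mul (by positivity)]
  · filter_upwards [ae_restrict_mem measurableSet_Ioi] with t ht
    have : (0 : ℝ) < t := ht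
    simp only [Pi.zero_apply]
    positivity

theorem enorm_rpow_mul_rieszKernel_sub {a : ℝ} (ha : 0 < a) (had : a < finrank ℝ E) {x : E}
    (hx : x ≠ 0) :
    ‖x‖ₑ ^ a * rieszKernel (finrank ℝ E - a) x =
      ENNReal.ofReal (rieszConst (finrank ℝ E) (finrank ℝ E - a)) := by
  rw [rieszKernel_eq (by linarith) (by linarith) hx, mul_left_comm,
    ← ENNReal.rpow_add _ _ (by simpa using hx) enorm_ne_top]
  simp

variable [MeasurableSpace E] [BorelSpace E]

@[fun_prop]
theorem measurable_heatKernel : Measurable fun p : ℝ × E => heatKernel p.1 p.2 := by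
  unfold heatKernel
  fun_prop

@[fun_prop]
theorem measurable_rieszKernel (a : ℝ) : Measurable (rieszKernel a : E → ℝ≥0∞) := by
  unfold rieszKernel
  refine Measurable.lintegral_prod_left'
    (f := fun p : ℝ × E => powDensity (a / 2) p.1 * heatKernel p.1 p.2) ?_
  exact ((measurable_powDensity _).comp measurable_fst).mul measurable_heatKernel

variable [FiniteDimensional ℝ E]

theorem lintegral_heatKernel_mul_heatKernel {s t : ℝ} (hs : 0 < s) (ht : 0 < t) (x : E) :
    ∫⁻ y, heatKernel s (x - y) * heatKernel t y = heatKernel (s + t) x := by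
  have hst : 0 < s + t := add_pos hs ht
  set d : ℝ := finrank ℝ E / 2 with hd
  set b : ℝ := π * (s + t) / (s * t) with hb
  have hbpos : 0 < b := by positivity
  have hsq (y : E) : ‖x - y‖ ^ 2 / s + ‖y‖ ^ 2 / t =
      (s + t) / (s * t) * ‖y - (t / (s + t)) • x‖ ^ 2 + ‖x‖ ^ 2 / (s + t) := by
    rw [norm_sub_sq_real, norm_sub_sq_real, norm_smul, real_inner_smul_right, real_inner_comm,
      norm_of_nonneg (by positivity)]
    field_simp
    ring
  have hpt (y : E) : heatKernel s (x - y) * heatKernel t y =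
      ENNReal.ofReal ((s * t) ^ (-d) * exp (-(π * ‖x‖ ^ 2 / (s + t)))) *
        ENNReal.ofReal (exp (-b * ‖y - (t / (s + t)) • x‖ ^ 2)) := by
    rw [heatKernel, heatKernel, ← ENNReal.ofReal_mul (by positivity),
      ← ENNReal.ofReal_mul (by positivity), ← hd]
    congr 1
    rw [mul_rpow hs.le ht.le]
    have : exp (-(π * ‖x - y‖ ^ 2 / s)) * exp (-(π * ‖y‖ ^ 2 / t)) =
        exp (-(π * ‖x‖ ^ 2 / (s + t))) * exp (-b * ‖y - (t / (s + t)) • x‖ ^ 2) := by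
      rw [← exp_add, ← exp_add]
      congr 1
      linear_combination (-π) * hsq y
    linear_combination (s ^ (-d) * t ^ (-d)) * this
  simp_rw [hpt]
  rw [lintegral_const_mul' _ _ ENNReal.ofReal_ne_top,
    lintegral_sub_right_eq_self (fun y : E => ENNReal.ofReal (exp (-b * ‖y‖ ^ 2))),
    lintegral_ofReal_of_integral_pos (Filter.Eventually.of_forall fun _ => (exp_pos _).le)
      (by rw [GaussianFourier.integral_rexp_neg_mul_sq_norm hbpos]; positivity),
    GaussianFourier.integral_rexp_neg_mul_sq_norm hbpos, ← ENNReal.ofReal_mul (by positivity),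
    heatKernel]
  congr 1
  rw [← hd, hb, show π / (π * (s + t) / (s * t)) = s * t / (s + t) by field_simp,
    div_rpow (by positivity) hst.le, rpow_neg (by positivity), rpow_neg hst.le]
  field_simp

/-- The Riesz kernels form a convolution semigroup. -/
theorem lintegral_rieszKernel_mul_rieszKernel {a b : ℝ} (ha : 0 < a) (hb : 0 < b) (x : E) :
    ∫⁻ y, rieszKernel a (x - y) * rieszKernel b y = rieszKernel (a + b) x := by
  have hm (y : E) : rieszKernel a (x - y) * rieszKernel b y =
      ∫⁻ u, ∫⁻ v, powDensity (a / 2) u * powDensity (b / 2) v *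
        (heatKernel u (x - y) * heatKernel v y) := by
    have h1 (c : ℝ) (z : E) : Measurable fun v => powDensity c v * heatKernel v z := by
      fun_prop
    rw [rieszKernel, rieszKernel, ← lintegral_mul_const _ (h1 _ _)]
    refine lintegral_congr fun u => ?_
    rw [← lintegral_const_mul _ (h1 _ _)]
    exact lintegral_congr fun v => by ring
  simp_rw [hm]
  rw [lintegral_lintegral_swap]
  · have h2 (u : ℝ) : ∫⁻ y : E, ∫⁻ v, powDensity (a / 2) u * powDensity (b / 2) v *
        (heatKernel u (x - y) * heatKernel v y) =
        ∫⁻ v, powDensity (a / 2) u * powDensity (b / 2) v * heatKernel (u + v) x := by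
      rw [lintegral_lintegral_swap]
      · refine lintegral_congr fun v => ?_
        rcases le_or_gt u 0 with hu | hu
        · simp [powDensity_of_nonpos _ hu]
        rcases le_or_gt v 0 with hv | hv
        · simp [powDensity_of_nonpos _ hv]
        rw [lintegral_const_mul _ (by fun_prop), lintegral_heatKernel_mul_heatKernel hu hv]
      · fun_prop
    simp_rw [h2]
    rw [lintegral_lintegral_powDensity (half_pos ha) (half_pos hb)
      (φ := fun r => heatKernel r x) (by fun_prop), rieszKernel, add_div]
  · refine Measurable.aemeasurable ?_
    refine Measurable.lintegral_prod_right' (f := fun p : (E × ℝ) × ℝ =>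
      powDensity (a / 2) p.1.2 * powDensity (b / 2) p.2 *
        (heatKernel p.1.2 (x - p.1.1) * heatKernel p.2 p.1.1)) ?_
    fun_prop

/-- The distribution of a sum of vectors distributed according to Riesz kernels. -/
theorem lintegral_prod_rieszKernel (m : ℕ) (a : Fin (m + 1) → ℝ) (ha : ∀ k, 0 < a k)
    {φ : E → ℝ≥0∞} (hφ : Measurable φ) :
    ∫⁻ ξ : Fin (m + 1) → E, (∏ k, rieszKernel (a k) (ξ k)) * φ (∑ k, ξ k) =
      ∫⁻ η, rieszKernel (∑ k, a k) η * φ η := by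
  induction m generalizing φ with
  | zero =>
    rw [← (volume_preserving_funUnique (Fin 1) E).lintegral_comp (by fun_prop)]
    refine lintegral_congr fun ξ => ?_
    simp [Subsingleton.elim (default : Fin 1) 0]
  | succ m ih =>
    rw [← (volume_preserving_piFinSuccAbove (fun _ : Fin (m + 2) => E) 0).symm.lintegral_comp
      (by fun_prop), Measure.volume_eq_prod, lintegral_prod _ (by fun_prop)]
    simp only [MeasurableEquiv.piFinSuccAbove_symm_apply, Fin.prod_univ_succ (n := m + 1),
      Fin.sum_univ_succ (n := m + 1), Fin.insertNthEquiv,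
      Equiv.coe_fn_mk, Fin.insertNth_zero, Fin.cons_zero, Fin.cons_succ, cast_eq]
    have hA : 0 < ∑ k : Fin (m + 1), a k.succ :=
      Finset.sum_pos (fun k _ => ha _) Finset.univ_nonempty
    have h1 (x : E) : ∫⁻ ξ : Fin (m + 1) → E, rieszKernel (a 0) x *
        (∏ k, rieszKernel (a k.succ) (ξ k)) * φ (x + ∑ k, ξ k) =
        ∫⁻ η, rieszKernel (a 0) x * rieszKernel (∑ k : Fin (m + 1), a k.succ) (η - x) * φ η := by
      simp_rw [mul_assoc]
      rw [lintegral_const_mul _ (by fun_prop), lintegral_const_mul _ (by fun_prop),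
        ih (fun k => a k.succ) (fun k => ha _) (φ := fun y => φ (x + y)) (by fun_prop),
        ← lintegral_sub_right_eq_self _ x]
      simp
    simp_rw [h1]
    rw [lintegral_lintegral_swap (by fun_prop)]
    refine lintegral_congr fun η => ?_
    rw [lintegral_mul_const _ (by fun_prop), add_comm (a 0),
      ← lintegral_rieszKernel_mul_rieszKernel hA (ha 0)]
    simp_rw [mul_comm]

end Riesz

section Fourier

open FourierTransform

theorem volume_preserving_toLp_pi (ι E : Type*) [Fintype ι] [NormedAddCommGroup E]
    [InnerProductSpace ℝ E] [FiniteDimensional ℝ E] [MeasurableSpace E] [BorelSpace E] :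
    MeasurePreserving (MeasurableEquiv.toLp 2 (ι → E)) volume volume := by
  set e := MeasurableEquiv.toLp 2 (ι → E)
  refine ⟨e.measurable, ?_⟩
  have hh : (volume.map e : Measure (PiLp 2 fun _ : ι => E)).IsAddHaarMeasure := by
    exact ((PiLp.continuousLinearEquiv 2 ℝ (fun _ : ι => E)).symm).isAddHaarMeasure_map volume
  have hc := Measure.isAddLeftInvariant_eq_smul (volume.map e)
    (volume : Measure (PiLp 2 fun _ : ι => E))
  set c := Measure.addHaarScalarFactor (volume.map e) (volume : Measure (PiLp 2 fun _ : ι => E))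
  have h1 : ∫ x, exp (-π * ‖x‖ ^ 2) ∂(volume.map e) = 1 := by
    rw [integral_map_equiv]
    have (x : ι → E) : exp (-π * ‖e x‖ ^ 2) = ∏ i, exp (-π * ‖x i‖ ^ 2) := by
      rw [← exp_sum, ← Finset.mul_sum]
      congr 2
      exact PiLp.norm_sq_eq_of_L2 _ _
    simp_rw [this]
    rw [integral_fintype_prod_volume_eq_pow (fun x : E => exp (-π * ‖x‖ ^ 2)),
      GaussianFourier.integral_rexp_neg_mul_sq_norm pi_pos, div_self pi_pos.ne', one_rpow, one_pow]
  rw [hc, integral_smul_nnreal_measure, GaussianFourier.integral_rexp_neg_mul_sq_norm pi_pos,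
    div_self pi_pos.ne', one_rpow] at h1
  rw [hc]
  have : c = 1 := by simpa [NNReal.smul_def] using h1
  simp [this]

/-- Fourier inversion for `fourierM`. -/
theorem fourierM_inversion {m n : ℕ}
    (f : SchwartzMap (Fin m → EuclideanSpace ℝ (Fin n)) ℂ) :
    Continuous (fourierM f) ∧ Integrable (fourierM f) ∧
      ∀ x, f x = ∫ ξ, Complex.exp (((-2 * π * ∑ k, ⟪x k, ξ k⟫_ℝ : ℝ) : ℂ) * Complex.I) *
        fourierM f ξ := by
  let V := PiLp 2 fun _ : Fin m => EuclideanSpace ℝ (Fin n)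
  let L : V ≃L[ℝ] (Fin m → EuclideanSpace ℝ (Fin n)) := PiLp.continuousLinearEquiv 2 ℝ _
  let g : SchwartzMap V ℂ := SchwartzMap.compCLMOfContinuousLinearEquiv ℂ L f
  have hvp := volume_preserving_toLp_pi (Fin m) (EuclideanSpace ℝ (Fin n))
  have hg (x) : g (WithLp.toLp 2 x) = f x := rfl
  have hF (ξ) : fourierM f ξ = 𝓕⁻ g (WithLp.toLp 2 ξ) := by
    rw [SchwartzMap.fourierInv_coe, fourierInv_eq',
      ← hvp.integral_comp (MeasurableEquiv.measurableEmbedding _)]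
    refine integral_congr_ae (Filter.Eventually.of_forall fun x => ?_)
    have h : ⟪WithLp.toLp 2 x, WithLp.toLp 2 ξ⟫_ℝ = ∑ k, ⟪x k, ξ k⟫_ℝ := PiLp.inner_apply _ _
    simp only [MeasurableEquiv.coe_toLp, h, hg, smul_eq_mul]
    congr 2
    push_cast
    ring
  have hF' : fourierM f = (𝓕⁻ g : SchwartzMap V ℂ) ∘ MeasurableEquiv.toLp 2 _ := funext hF
  refine ⟨?_, ?_, fun x => ?_⟩
  · rw [hF']
    exact (𝓕⁻ g).continuous.comp (PiLp.continuous_toLp 2 _)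
  · rw [hF', hvp.integrable_comp_emb (MeasurableEquiv.measurableEmbedding _)]
    exact (𝓕⁻ g).integrable
  · have : f x = 𝓕 (𝓕⁻ g) (WithLp.toLp 2 x) := by simp [hg]
    rw [this, SchwartzMap.fourier_coe, fourier_eq',
      ← hvp.integral_comp (MeasurableEquiv.measurableEmbedding _)]
    refine integral_congr_ae (Filter.Eventually.of_forall fun ξ => ?_)
    have h : ⟪WithLp.toLp 2 ξ, WithLp.toLp 2 x⟫_ℝ = ∑ k, ⟪x k, ξ k⟫_ℝ := by
      rw [real_inner_comm]
      exact PiLp.inner_apply _ _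
    simp only [MeasurableEquiv.coe_toLp, h, hF, smul_eq_mul]

end Fourier

section GaussianBound

variable {E : Type*} [NormedAddCommGroup E] [InnerProductSpace ℝ E] [FiniteDimensional ℝ E]
  [MeasurableSpace E] [BorelSpace E]

theorem integral_gaussian_mul_cexp {t : ℝ} (ht : 0 < t) (w : E) :
    ∫ x : E, (exp (-(π * ‖x‖ ^ 2 * t)) : ℂ) *
        Complex.exp (((-2 * π * ⟪x, w⟫_ℝ : ℝ) : ℂ) * Complex.I) =
      ((t ^ (-(Module.finrank ℝ E / 2 : ℝ)) * exp (-(π * ‖w‖ ^ 2 / t)) : ℝ) : ℂ) := by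
  have h := GaussianFourier.integral_cexp_neg_mul_sq_norm_add (V := E)
    (b := ((π * t : ℝ) : ℂ)) (by simpa using mul_pos pi_pos ht) (-2 * π * Complex.I) w
  have hl (x : E) : (exp (-(π * ‖x‖ ^ 2 * t)) : ℂ) *
      Complex.exp (((-2 * π * ⟪x, w⟫_ℝ : ℝ) : ℂ) * Complex.I) =
      Complex.exp (-((π * t : ℝ) : ℂ) * ‖x‖ ^ 2 + -2 * π * Complex.I * ⟪w, x⟫_ℝ) := by
    rw [Complex.ofReal_exp, ← Complex.exp_add, real_inner_comm]
    push_cast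
    ring_nf
  simp_rw [hl]
  rw [h, Complex.ofReal_mul (t ^ _), Complex.ofReal_exp, rpow_neg ht.le, ← inv_rpow ht.le,
    Complex.ofReal_cpow (by positivity)]
  congr 1
  · congr 1
    · push_cast
      field_simp
    · push_cast
      rfl
  · congr 1
    have h1 : (t : ℂ) ≠ 0 := by exact_mod_cast ht.ne'
    have h2 : (π : ℂ) ≠ 0 := by exact_mod_cast pi_pos.ne'
    push_cast
    field_simp
    rw [Complex.I_sq]
    ring

/-- The Gaussian-weighted `L²` norm of a superposition of characters is controlled by the heat
kernel energy of its coefficients. -/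
theorem lintegral_gaussian_mul_sq_le {X : Type*} [MeasurableSpace X] {μ : Measure X}
    [SFinite μ] {F : X → ℂ} (hF : Integrable F μ) {σ : X → E} (hσ : Measurable σ)
    {t : ℝ} (ht : 0 < t) :
    ∫⁻ x : E, ENNReal.ofReal (exp (-(π * ‖x‖ ^ 2 * t))) *
        ‖∫ ξ, Complex.exp (((-2 * π * ⟪x, σ ξ⟫_ℝ : ℝ) : ℂ) * Complex.I) * F ξ ∂μ‖ₑ ^ 2 ≤
      ∫⁻ p : X × X, ‖F p.1‖ₑ * ‖F p.2‖ₑ * heatKernel t (σ p.1 - σ p.2) ∂(μ.prod μ) := by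
  set e : E → E → ℂ := fun x y => Complex.exp (((-2 * π * ⟪x, y⟫_ℝ : ℝ) : ℂ) * Complex.I) with he
  set g : E → ℂ := fun x => ∫ ξ, e x (σ ξ) * F ξ ∂μ with hg
  set γ : E → ℂ := fun x => (exp (-(π * ‖x‖ ^ 2 * t)) : ℂ) with hγ
  have hconj (x y : E) : (starRingEnd ℂ) (e x y) = e x (-y) := by
    simp only [he, ← Complex.exp_conj, map_mul, Complex.conj_ofReal, Complex.conj_I,
      inner_neg_right]
    push_cast
    ring_nf
  have hadd (x y z : E) : e x y * e x (-z) = e x (y - z) := by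
    simp only [he, ← Complex.exp_add, inner_neg_right, inner_sub_right]
    push_cast
    ring_nf
  have hsq (x : E) : γ x * (g x * (starRingEnd ℂ) (g x)) =
      ∫ p : X × X, γ x * e x (σ p.1 - σ p.2) * (F p.1 * (starRingEnd ℂ) (F p.2)) ∂(μ.prod μ) := by
    rw [hg, ← integral_conj, ← integral_prod_mul, ← integral_const_mul]
    refine integral_congr_ae (Filter.Eventually.of_forall fun p => ?_)
    simp only [map_mul, hconj, ← hadd]
    ring
  have hγi : Integrable γ := by
    have := GaussianFourier.integrable_cexp_neg_mul_sq_norm_add (V := E)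
      (b := ((π * t : ℝ) : ℂ)) (by simpa using mul_pos pi_pos ht) 0 0
    refine this.congr (Filter.Eventually.of_forall fun x => ?_)
    simp only [hγ, Complex.ofReal_exp]
    push_cast
    ring_nf
  have hFF : Integrable (fun p : X × X => F p.1 * (starRingEnd ℂ) (F p.2)) (μ.prod μ) :=
    hF.mul_prod (Complex.conjCLE.toContinuousLinearMap.integrable_comp hF)
  have hprod : Integrable (fun q : E × (X × X) =>
      γ q.1 * e q.1 (σ q.2.1 - σ q.2.2) * (F q.2.1 * (starRingEnd ℂ) (F q.2.2)))
      (volume.prod (μ.prod μ)) := by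
    have h0 := hγi.mul_prod hFF
    have hm : Measurable fun q : E × (X × X) => e q.1 (σ q.2.1 - σ q.2.2) := by
      simp only [he]
      fun_prop
    have h1 := h0.bdd_mul (c := 1) hm.aestronglyMeasurable
      (Filter.Eventually.of_forall fun q => (Complex.norm_exp_ofReal_mul_I _).le)
    refine h1.congr (Filter.Eventually.of_forall fun q => ?_)
    simp only
    ring
  have hI : ∫ x, γ x * (g x * (starRingEnd ℂ) (g x)) =
      ∫ p : X × X, ((t ^ (-(Module.finrank ℝ E / 2 : ℝ)) *
        exp (-(π * ‖σ p.1 - σ p.2‖ ^ 2 / t)) : ℝ) : ℂ) *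
        (F p.1 * (starRingEnd ℂ) (F p.2)) ∂(μ.prod μ) := by
    simp_rw [hsq]
    rw [integral_integral_swap hprod]
    refine integral_congr_ae (Filter.Eventually.of_forall fun p => ?_)
    simp only
    rw [integral_mul_const, integral_gaussian_mul_cexp ht]
  have hgi : Integrable fun x => γ x * (g x * (starRingEnd ℂ) (g x)) := by
    simp_rw [hsq]
    exact hprod.integral_prod_left
  have hnorm (x : E) : γ x * (g x * (starRingEnd ℂ) (g x)) =
      ((exp (-(π * ‖x‖ ^ 2 * t)) * ‖g x‖ ^ 2 : ℝ) : ℂ) := by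
    rw [Complex.mul_conj', hγ]
    push_cast
    rfl
  calc _ = ∫⁻ x, ENNReal.ofReal (exp (-(π * ‖x‖ ^ 2 * t)) * ‖g x‖ ^ 2) := by
        refine lintegral_congr fun x => ?_
        rw [ENNReal.ofReal_mul (exp_pos _).le, ENNReal.ofReal_pow (norm_nonneg _), ofReal_norm]
    _ = ENNReal.ofReal (∫ x, exp (-(π * ‖x‖ ^ 2 * t)) * ‖g x‖ ^ 2) := by
        rw [ofReal_integral_eq_lintegral_ofReal]
        · simp_rw [hnorm] at hgi
          exact hgi.re
        · exact Filter.Eventually.of_forall fun x => by simp only [Pi.zero_apply]; positivity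
    _ = ‖∫ x, γ x * (g x * (starRingEnd ℂ) (g x))‖ₑ := by
        simp_rw [hnorm]
        rw [integral_complex_ofReal, ← ofReal_norm, Complex.norm_real, norm_of_nonneg]
        exact integral_nonneg fun x => by positivity
    _ ≤ _ := by
        rw [hI]
        refine (enorm_integral_le_lintegral_enorm _).trans (lintegral_mono fun p => ?_)
        rw [enorm_mul, enorm_mul, ← ofReal_norm (Complex.ofReal _), Complex.norm_real,
          norm_of_nonneg (by positivity), RCLike.enorm_conj, mul_comm, heatKernel]

end GaussianBound

section Schur

theorem ENNReal.two_mul_mul_le_sq_add_sq (a b : ℝ≥0∞) : 2 * (a * b) ≤ a ^ 2 + b ^ 2 := by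
  wlog h : a ≤ b generalizing a b
  · rw [mul_comm a, add_comm]
    exact this b a (le_of_not_ge h)
  obtain ⟨c, rfl⟩ := exists_add_of_le h
  calc 2 * (a * (a + c)) ≤ 2 * (a * (a + c)) + c ^ 2 := le_self_add
    _ = a ^ 2 + (a + c) ^ 2 := by ring

theorem ENNReal.two_mul_mul_le_sq_mul_div_add (a b : ℝ≥0∞) {u v : ℝ≥0∞} (hu : u ≠ 0)
    (hu' : u ≠ ∞) (hv : v ≠ 0) (hv' : v ≠ ∞) :
    2 * (a * b) ≤ a ^ 2 * (v / u) + b ^ 2 * (u / v) := by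
  set r : ℝ≥0∞ := (v / u) ^ (1 / 2 : ℝ)
  have hr : r ^ 2 = v / u := by
    rw [← ENNReal.rpow_natCast, ← ENNReal.rpow_mul]
    norm_num
  have hr0 : v / u ≠ 0 := ENNReal.div_ne_zero.2 ⟨hv, hu'⟩
  have hrt : v / u ≠ ∞ := ENNReal.div_ne_top hv' hu
  have h1 : r ≠ 0 := by rintro h; simp [h] at hr; exact hr0 hr.symm
  have h2 : r ≠ ∞ := by rintro h; simp [h] at hr; exact hrt hr.symm
  have h3 : (r⁻¹) ^ 2 = u / v := by
    rw [← ENNReal.inv_pow, hr, ENNReal.inv_div (Or.inl hu') (Or.inl hu)]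
  calc 2 * (a * b) = 2 * ((a * r) * (b * r⁻¹)) := by
        rw [mul_mul_mul_comm, ENNReal.mul_inv_cancel h1 h2, mul_one]
    _ ≤ (a * r) ^ 2 + (b * r⁻¹) ^ 2 := ENNReal.two_mul_mul_le_sq_add_sq _ _
    _ = _ := by rw [mul_pow, mul_pow, hr, h3]

/-- Schur's test for a symmetric nonnegative kernel. -/
theorem lintegral_mul_mul_kernel_le {X : Type*} [MeasurableSpace X] {μ : Measure X} [SFinite μ]
    {K : X → X → ℝ≥0∞} (hK : Measurable fun p : X × X => K p.1 p.2)
    (hsymm : ∀ x y, K x y = K y x) {w Q h : X → ℝ≥0∞} (hw : Measurable w) (hh : Measurable h)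
    (hw0 : ∀ᵐ x ∂μ, w x ≠ 0 ∧ w x ≠ ∞)
    (hQ : ∀ᵐ x ∂μ, ∫⁻ y, K x y * w y ∂μ ≤ Q x * w x) :
    ∫⁻ p : X × X, h p.1 * h p.2 * K p.1 p.2 ∂(μ.prod μ) ≤ ∫⁻ x, Q x * h x ^ 2 ∂μ := by
  set A : X × X → ℝ≥0∞ := fun p => h p.1 ^ 2 * (w p.2 / w p.1) * K p.1 p.2 with hA
  have hAm : Measurable A := by fun_prop
  have hAle : ∫⁻ p, A p ∂(μ.prod μ) ≤ ∫⁻ x, Q x * h x ^ 2 ∂μ := by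
    rw [lintegral_prod _ hAm.aemeasurable]
    refine lintegral_mono_ae ?_
    filter_upwards [hw0, hQ] with x hx hQx
    calc ∫⁻ y, A (x, y) ∂μ = h x ^ 2 / w x * ∫⁻ y, K x y * w y ∂μ := by
          rw [← lintegral_const_mul _ (by fun_prop)]
          refine lintegral_congr fun y => ?_
          simp only [hA, ENNReal.div_eq_inv_mul]
          ring
      _ ≤ h x ^ 2 / w x * (Q x * w x) := by gcongr
      _ = Q x * h x ^ 2 * ((w x)⁻¹ * w x) := by rw [ENNReal.div_eq_inv_mul]; ring
      _ = _ := by rw [ENNReal.inv_mul_cancel hx.1 hx.2, mul_one]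
  have hswap : ∫⁻ p : X × X, A p.swap ∂(μ.prod μ) = ∫⁻ p, A p ∂(μ.prod μ) :=
    lintegral_prod_swap A
  have h2 : 2 * ∫⁻ p : X × X, h p.1 * h p.2 * K p.1 p.2 ∂(μ.prod μ) ≤
      2 * ∫⁻ x, Q x * h x ^ 2 ∂μ := by
    calc _ = ∫⁻ p : X × X, 2 * (h p.1 * h p.2 * K p.1 p.2) ∂(μ.prod μ) :=
          (lintegral_const_mul _ (by fun_prop)).symm
      _ ≤ ∫⁻ p : X × X, A p + A p.swap ∂(μ.prod μ) := by
          refine lintegral_mono_ae ?_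
          filter_upwards [Measure.quasiMeasurePreserving_fst.ae hw0,
            Measure.quasiMeasurePreserving_snd.ae hw0] with p h1 h2
          simp only [hA, Prod.fst_swap, Prod.snd_swap, hsymm p.2 p.1, ← add_mul, ← mul_assoc]
          rw [mul_assoc 2]
          gcongr
          exact ENNReal.two_mul_mul_le_sq_mul_div_add _ _ h1.1 h1.2 h2.1 h2.2
      _ = 2 * ∫⁻ p, A p ∂(μ.prod μ) := by rw [lintegral_add_left hAm, hswap, two_mul]
      _ ≤ _ := by gcongr
  exact (ENNReal.mul_le_mul_iff_right two_ne_zero ENNReal.ofNat_ne_top).1 h2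

end Schur

section Pitt

variable {E : Type*} [NormedAddCommGroup E] [InnerProductSpace ℝ E] [FiniteDimensional ℝ E]
  [MeasurableSpace E] [BorelSpace E]

open Module (finrank)

/-- Weighted `L²` norms of a superposition of characters are controlled by the Riesz energy of its
coefficients. -/
theorem lintegral_enorm_rpow_mul_sq_le [Nontrivial E] {X : Type*} [MeasurableSpace X]
    {μ : Measure X} [SFinite μ] {F : X → ℂ} (hF : Integrable F μ) {σ : X → E}
    (hσ : Measurable σ) (hFm : Measurable F) {β : ℝ} (hβ : 0 < β) :
    ∫⁻ x : E, ‖x‖ₑ ^ (-β) *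
        ‖∫ ξ, Complex.exp (((-2 * π * ⟪x, σ ξ⟫_ℝ : ℝ) : ℂ) * Complex.I) * F ξ ∂μ‖ₑ ^ 2 ≤
      ENNReal.ofReal (π ^ (β / 2)) *
        ∫⁻ p : X × X, ‖F p.1‖ₑ * ‖F p.2‖ₑ * rieszKernel β (σ p.1 - σ p.2) ∂(μ.prod μ) := by
  set g : E → ℂ := fun x =>
    ∫ ξ, Complex.exp (((-2 * π * ⟪x, σ ξ⟫_ℝ : ℝ) : ℂ) * Complex.I) * F ξ ∂μ with hg
  have hgm : Measurable g := by
    refine (StronglyMeasurable.integral_prod_right (f := fun x ξ =>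
      Complex.exp (((-2 * π * ⟪x, σ ξ⟫_ℝ : ℝ) : ℂ) * Complex.I) * F ξ) ?_).measurable
    exact Measurable.stronglyMeasurable (by fun_prop)
  have hsub {x : E} (hx : x ≠ 0) : ‖x‖ₑ ^ (-β) = ENNReal.ofReal (π ^ (β / 2)) *
      ∫⁻ t, powDensity (β / 2) t * ENNReal.ofReal (exp (-(π * ‖x‖ ^ 2 * t))) := by
    rw [lintegral_powDensity_mul_exp (half_pos hβ) hx, ← mul_assoc,
      ← ENNReal.ofReal_mul (by positivity), ← rpow_add pi_pos]
    simp [mul_div_cancel₀]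
  calc _ = ∫⁻ x : E, ENNReal.ofReal (π ^ (β / 2)) * ∫⁻ t, powDensity (β / 2) t *
          (ENNReal.ofReal (exp (-(π * ‖x‖ ^ 2 * t))) * ‖g x‖ₑ ^ 2) := by
        refine lintegral_congr_ae ?_
        filter_upwards [Measure.ae_ne volume (0 : E)] with x hx
        simp_rw [← mul_assoc]
        rw [lintegral_mul_const _ (by fun_prop), ← mul_assoc, hsub hx]
    _ = ENNReal.ofReal (π ^ (β / 2)) * ∫⁻ t, powDensity (β / 2) t *
          ∫⁻ x : E, ENNReal.ofReal (exp (-(π * ‖x‖ ^ 2 * t))) * ‖g x‖ₑ ^ 2 := by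
        rw [lintegral_const_mul' _ _ ENNReal.ofReal_ne_top, lintegral_lintegral_swap]
        · congr 1
          exact lintegral_congr fun t => lintegral_const_mul _ (by fun_prop)
        · fun_prop
    _ ≤ ENNReal.ofReal (π ^ (β / 2)) * ∫⁻ t, powDensity (β / 2) t *
          ∫⁻ p : X × X, ‖F p.1‖ₑ * ‖F p.2‖ₑ * heatKernel t (σ p.1 - σ p.2) ∂(μ.prod μ) := by
        gcongr _ * ?_
        refine lintegral_mono fun t => ?_
        rcases le_or_gt t 0 with ht | ht
        · simp [powDensity_of_nonpos _ ht]
        · gcongr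
          exact lintegral_gaussian_mul_sq_le hF hσ ht
    _ = _ := by
        have h (t : ℝ) : powDensity (β / 2) t * ∫⁻ p : X × X, ‖F p.1‖ₑ * ‖F p.2‖ₑ *
            heatKernel t (σ p.1 - σ p.2) ∂(μ.prod μ) = ∫⁻ p : X × X, ‖F p.1‖ₑ * ‖F p.2‖ₑ *
              (powDensity (β / 2) t * heatKernel t (σ p.1 - σ p.2)) ∂(μ.prod μ) := by
          rw [← lintegral_const_mul _ (by fun_prop)]
          exact lintegral_congr fun p => by ring
        simp_rw [h]
        rw [lintegral_lintegral_swap (by fun_prop)]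
        congr 1
        exact lintegral_congr fun p => lintegral_const_mul _ (by fun_prop)

theorem lintegral_rieszKernel_mul_prod [Nontrivial E] {m : ℕ} {a : Fin (m + 1) → ℝ}
    (ha : ∀ k, 0 < a k) {β : ℝ} (hβ : 0 < β) (hβd : β < finrank ℝ E)
    (hsum : ∑ k, a k = finrank ℝ E - β) {η : E} (hη : η ≠ 0) :
    ∫⁻ ξ : Fin (m + 1) → E, rieszKernel β (η - ∑ k, ξ k) *
        ((∏ k, rieszKernel (a k) (ξ k)) * ‖∑ k, ξ k‖ₑ ^ (-((finrank ℝ E - β) / 2))) =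
      ENNReal.ofReal (rieszConst (finrank ℝ E) (finrank ℝ E - β) /
        rieszConst (finrank ℝ E) ((finrank ℝ E - β) / 2) *
        rieszConst (finrank ℝ E) ((finrank ℝ E + β) / 2)) *
        ‖η‖ₑ ^ (-((finrank ℝ E - β) / 2)) := by
  set d : ℝ := (finrank ℝ E : ℝ) with hd
  have hk₁ : 0 < rieszConst d (d - β) := rieszConst_pos (by linarith) (by linarith)
  have hk₂ : 0 < rieszConst d ((d - β) / 2) := rieszConst_pos (by linarith) (by linarith)
  calc _ = ∫⁻ ξ : Fin (m + 1) → E, (∏ k, rieszKernel (a k) (ξ k)) *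
          (rieszKernel β (η - ∑ k, ξ k) * ‖∑ k, ξ k‖ₑ ^ (-((d - β) / 2))) :=
        lintegral_congr fun ξ => by ring
    _ = ∫⁻ y, rieszKernel (d - β) y * (rieszKernel β (η - y) * ‖y‖ₑ ^ (-((d - β) / 2))) := by
        rw [lintegral_prod_rieszKernel m a ha
          (φ := fun y => rieszKernel β (η - y) * ‖y‖ₑ ^ (-((d - β) / 2))) (by fun_prop), hsum]
    _ = ∫⁻ y, ENNReal.ofReal (rieszConst d (d - β) / rieszConst d ((d - β) / 2)) *
          (rieszKernel β (η - y) * rieszKernel ((d - β) / 2) y) := by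
        refine lintegral_congr_ae ?_
        filter_upwards [Measure.ae_ne volume (0 : E)] with y hy
        rw [rieszKernel_eq (by linarith) (by linarith) hy,
          rieszKernel_eq (a := (d - β) / 2) (by linarith) (by linarith) hy, ← hd]
        have hpow : ‖y‖ₑ ^ (-(d - (d - β))) * ‖y‖ₑ ^ (-((d - β) / 2)) =
            ‖y‖ₑ ^ (-(d - (d - β) / 2)) := by
          rw [← ENNReal.rpow_add _ _ (by simpa using hy) enorm_ne_top]
          ring_nf
        have hconst : ENNReal.ofReal (rieszConst d (d - β)) =
            ENNReal.ofReal (rieszConst d (d - β) / rieszConst d ((d - β) / 2)) *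
              ENNReal.ofReal (rieszConst d ((d - β) / 2)) := by
          rw [← ENNReal.ofReal_mul (by positivity), div_mul_cancel₀ _ hk₂.ne']
        rw [← hpow, hconst]
        ring
    _ = _ := by
        rw [lintegral_const_mul' _ _ ENNReal.ofReal_ne_top,
          lintegral_rieszKernel_mul_rieszKernel hβ (by linarith),
          show β + (d - β) / 2 = (d + β) / 2 by ring,
          rieszKernel_eq (by linarith) (by linarith) hη, ← hd, ← mul_assoc,
          ← ENNReal.ofReal_mul (by positivity), show d - (d + β) / 2 = (d - β) / 2 by ring]

theorem ae_linearMap_ne_zero {V W : Type*} [NormedAddCommGroup V] [NormedSpace ℝ V]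
    [FiniteDimensional ℝ V] [MeasurableSpace V] [BorelSpace V] {μ : Measure V}
    [μ.IsAddHaarMeasure] [AddCommGroup W] [Module ℝ W] {T : V →ₗ[ℝ] W} (hT : T ≠ 0) :
    ∀ᵐ x ∂μ, T x ≠ 0 := by
  simp only [ae_iff, not_not]
  exact Measure.addHaar_submodule μ (LinearMap.ker T) (by rwa [Ne, LinearMap.ker_eq_top])

/-- The Riesz energy of a function of several frequency variables is bounded by its
multilinear Dirichlet form. -/
theorem lintegral_rieszKernel_energy_le [Nontrivial E] {m : ℕ} {α : Fin (m + 1) → ℝ}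
    (hα : ∀ k, 0 < α k ∧ α k < finrank ℝ E) {β : ℝ} (hβ : 0 < β) (hβd : β < finrank ℝ E)
    (hsum : ∑ k, (finrank ℝ E - α k) = finrank ℝ E - β)
    {h : (Fin (m + 1) → E) → ℝ≥0∞} (hh : Measurable h) :
    ∫⁻ p : (Fin (m + 1) → E) × (Fin (m + 1) → E),
        h p.1 * h p.2 * rieszKernel β (∑ k, p.1 k - ∑ k, p.2 k) ≤
      ENNReal.ofReal (rieszConst (finrank ℝ E) (finrank ℝ E - β) /
        rieszConst (finrank ℝ E) ((finrank ℝ E - β) / 2) *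
        rieszConst (finrank ℝ E) ((finrank ℝ E + β) / 2) /
        ∏ k, rieszConst (finrank ℝ E) (finrank ℝ E - α k)) *
        ∫⁻ ξ, (∏ k, ‖ξ k‖ₑ ^ α k) * h ξ ^ 2 := by
  set d : ℝ := (finrank ℝ E : ℝ) with hd
  set A := rieszConst d (d - β) / rieszConst d ((d - β) / 2) * rieszConst d ((d + β) / 2)
  set B := ∏ k, rieszConst d (d - α k)
  have hA : 0 < A := by
    have hk₁ : 0 < rieszConst d (d - β) := rieszConst_pos (by linarith) (by linarith)
    have hk₂ : 0 < rieszConst d ((d - β) / 2) := rieszConst_pos (by linarith) (by linarith)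
    have hk₃ : 0 < rieszConst d ((d + β) / 2) := rieszConst_pos (by linarith) (by linarith)
    positivity
  have hBk (k) : 0 < rieszConst d (d - α k) :=
    rieszConst_pos (by linarith [(hα k).2]) (by linarith [(hα k).1])
  have hB : 0 < B := Finset.prod_pos fun k _ => hBk k
  have hne : ∀ᵐ ξ : Fin (m + 1) → E, (∀ k, ξ k ≠ 0) ∧ ∑ k, ξ k ≠ 0 := by
    obtain ⟨v, hv⟩ := exists_ne (0 : E)
    refine (ae_all_iff.2 fun k => ?_).and ?_
    · refine ae_linearMap_ne_zero (T := LinearMap.proj (R := ℝ) (φ := fun _ => E) k) fun h0 => hv ?_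
      simpa using LinearMap.congr_fun h0 (fun _ => v)
    · have := ae_linearMap_ne_zero (μ := (volume : Measure (Fin (m + 1) → E)))
        (T := ∑ k, LinearMap.proj (R := ℝ) (φ := fun _ => E) k) fun h0 => hv ?_
      · simpa using this
      · simpa using LinearMap.congr_fun h0 (Pi.single 0 v)
  have hprod {ξ : Fin (m + 1) → E} (hξ : ∀ k, ξ k ≠ 0) :
      (∏ k, ‖ξ k‖ₑ ^ α k) * ∏ k, rieszKernel (d - α k) (ξ k) = ENNReal.ofReal B := by
    rw [← Finset.prod_mul_distrib, ENNReal.ofReal_prod_of_nonneg fun k _ => (hBk k).le]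
    exact Finset.prod_congr rfl fun k _ =>
      enorm_rpow_mul_rieszKernel_sub (hα k).1 (hα k).2 (hξ k)
  have key := lintegral_mul_mul_kernel_le (μ := (volume : Measure (Fin (m + 1) → E)))
    (K := fun ξ ξ' => rieszKernel β (∑ k, ξ k - ∑ k, ξ' k)) (by fun_prop)
    (fun x y => by rw [← rieszKernel_neg, neg_sub])
    (w := fun ξ => (∏ k, rieszKernel (d - α k) (ξ k)) * ‖∑ k, ξ k‖ₑ ^ (-((d - β) / 2)))
    (Q := fun ξ => ENNReal.ofReal (A / B) * ∏ k, ‖ξ k‖ₑ ^ α k) (by fun_prop) hh ?_ ?_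
  · refine key.trans_eq ?_
    simp_rw [mul_assoc]
    exact lintegral_const_mul' _ _ ENNReal.ofReal_ne_top
  · filter_upwards [hne] with ξ hξ
    have hs₀ : ‖∑ k, ξ k‖ₑ ^ (-((d - β) / 2)) ≠ 0 := by simp [ENNReal.rpow_eq_zero_iff, hξ.2]
    have hs₁ : ‖∑ k, ξ k‖ₑ ^ (-((d - β) / 2)) ≠ ∞ := by
      simp [ENNReal.rpow_eq_top_iff, hξ.2]
    have hx (k) : ‖ξ k‖ₑ ^ α k ≠ 0 := by simp [ENNReal.rpow_eq_zero_iff, hξ.1 k]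
    have hx' : ∏ k, ‖ξ k‖ₑ ^ α k ≠ 0 := Finset.prod_ne_zero_iff.2 fun k _ => hx k
    have hp := hprod hξ.1
    refine ⟨mul_ne_zero (fun h0 => ?_) hs₀, ENNReal.mul_ne_top (fun h0 => ?_) hs₁⟩
    · rw [h0, mul_zero] at hp
      exact (ENNReal.ofReal_pos.2 hB).ne hp
    · rw [h0, ENNReal.mul_top hx'] at hp
      exact ENNReal.ofReal_ne_top hp.symm
  · filter_upwards [hne] with ξ hξ
    rw [lintegral_rieszKernel_mul_prod (fun k => sub_pos.2 (hα k).2) hβ hβd hsum hξ.2, ← hd,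
      mul_assoc, ← mul_assoc (∏ k, ‖ξ k‖ₑ ^ α k), hprod hξ.1, ← mul_assoc,
      ← ENNReal.ofReal_mul (by positivity), div_mul_cancel₀ _ hB.ne']

theorem pitt_const_eq {m n : ℕ} {α : Fin m → ℝ} {β : ℝ}
    (hβ : β = (∑ k, α k) - ((m : ℝ) - 1) * n) :
    π ^ (β / 2) * (rieszConst n (n - β) / rieszConst n ((n - β) / 2) *
      rieszConst n ((n + β) / 2) / ∏ k, rieszConst n (n - α k)) =
    π ^ (-((m : ℝ) - 1) * n / 2 + ∑ k, α k) *
      (∏ k, Gamma (((n : ℝ) - α k) / 2) / Gamma (α k / 2)) *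
      (Gamma (β / 2) / Gamma (((n : ℝ) - β) / 2)) *
      (Gamma (((n : ℝ) - β) / 4) / Gamma (((n : ℝ) + β) / 4)) ^ 2 := by
  have h1 (a : ℝ) : rieszConst n (n - a) =
      π ^ (-(a / 2)) * Gamma (a / 2) / Gamma ((n - a) / 2) := by
    rw [rieszConst, sub_sub_cancel]
  have h2 : ∏ k, rieszConst n (n - α k) =
      π ^ (-((∑ k, α k) / 2)) / ∏ k, Gamma (((n : ℝ) - α k) / 2) / Gamma (α k / 2) := by
    simp_rw [h1]
    rw [Finset.sum_div, ← Finset.sum_neg_distrib, rpow_sum_of_pos pi_pos, ← Finset.prod_div_distrib]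
    refine Finset.prod_congr rfl fun k _ => ?_
    rw [div_div_eq_mul_div]
  rw [h2, h1, rieszConst, rieszConst, show ((n : ℝ) - (n - β) / 2) / 2 = (n + β) / 4 by ring,
    show ((n : ℝ) - (n + β) / 2) / 2 = (n - β) / 4 by ring,
    show ((n : ℝ) - β) / 2 / 2 = (n - β) / 4 by ring,
    show ((n : ℝ) + β) / 2 / 2 = (n + β) / 4 by ring]
  have hpi : π ^ (β / 2) * π ^ (-(β / 2)) * (π ^ (-(((n : ℝ) + β) / 4)))⁻¹ *
      π ^ (-(((n : ℝ) - β) / 4)) * (π ^ (-((∑ k, α k) / 2)))⁻¹ =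
      π ^ (-((m : ℝ) - 1) * n / 2 + ∑ k, α k) := by
    simp only [← rpow_neg pi_pos.le, ← rpow_add pi_pos]
    congr 1
    rw [hβ]
    ring
  rw [← hpi]
  simp only [div_eq_mul_inv, mul_inv, inv_inv]
  ring

end Pitt

/-- **Multilinear Pitt inequality.**  For `0 < α_k < n`, `(m−1)n < α = Σ α_k < mn`
and `β = α − (m−1)n`, every Schwartz `f` satisfies
`∫ |x|^{−β} |f(x,…,x)|² dx ≤ C_β · Λ(f; α_1,…,α_m)`. -/
theorem stmt4 (m n : ℕ) (hm : 1 ≤ m) (hn : 1 ≤ n)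
    (α : Fin m → ℝ) (hα : ∀ k, 0 < α k ∧ α k < n)
    (hlow : ((m : ℝ) - 1) * n < ∑ k, α k) (hhigh : (∑ k, α k) < m * n)
    (β : ℝ) (hβ : β = (∑ k, α k) - ((m : ℝ) - 1) * n)
    (f : SchwartzMap (Fin m → EuclideanSpace ℝ (Fin n)) ℂ) :
    (∫⁻ x : EuclideanSpace ℝ (Fin n),
        ENNReal.ofReal (‖x‖ ^ (-β)) * (‖f (fun _ => x)‖₊ : ℝ≥0∞) ^ (2 : ℕ)) ≤
      ENNReal.ofReal
        (Real.pi ^ (-((m : ℝ) - 1) * n / 2 + ∑ k, α k) *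
          (∏ k, Real.Gamma (((n : ℝ) - α k) / 2) / Real.Gamma (α k / 2)) *
          (Real.Gamma (β / 2) / Real.Gamma (((n : ℝ) - β) / 2)) *
          (Real.Gamma (((n : ℝ) - β) / 4) / Real.Gamma (((n : ℝ) + β) / 4)) ^ 2) *
        LamM (fun x => f x) α := by
  obtain ⟨m, rfl⟩ : ∃ m', m = m' + 1 := ⟨m - 1, by omega⟩
  have hd : Module.finrank ℝ (EuclideanSpace ℝ (Fin n)) = n := finrank_euclideanSpace_fin
  have : Nontrivial (EuclideanSpace ℝ (Fin n)) :=
    Module.nontrivial_of_finrank_pos (R := ℝ) (by omega)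
  have hβ0 : 0 < β := by linarith
  have hβn : β < n := by
    push_cast at hβ hhigh
    linarith
  have hsum : ∑ k, ((n : ℝ) - α k) = n - β := by
    rw [Finset.sum_sub_distrib, hβ]
    simp only [Finset.sum_const, Finset.card_univ, Fintype.card_fin, nsmul_eq_mul]
    ring
  obtain ⟨hFc, hFi, hinv⟩ := fourierM_inversion f
  have hdiag (x : EuclideanSpace ℝ (Fin n)) : f (fun _ => x) =
      ∫ ξ, Complex.exp (((-2 * π * ⟪x, ∑ k, ξ k⟫_ℝ : ℝ) : ℂ) * Complex.I) *
        fourierM (fun x => f x) ξ := by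
    simp_rw [inner_sum]
    exact hinv _
  have hLam : LamM (fun x => f x) α =
      ∫⁻ ξ, (∏ k, ‖ξ k‖ₑ ^ α k) * ‖fourierM (fun x => f x) ξ‖ₑ ^ 2 := by
    refine lintegral_congr fun ξ => ?_
    simp_rw [← ENNReal.ofReal_rpow_of_nonneg (norm_nonneg _) (hα _).1.le, ofReal_norm]
    rfl
  have henergy := lintegral_rieszKernel_energy_le (E := EuclideanSpace ℝ (Fin n)) (α := α)
    (β := β) (h := fun ξ => ‖fourierM (fun x => f x) ξ‖ₑ) (by rwa [hd]) hβ0 (by rwa [hd])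
    (by rwa [hd]) (by fun_prop)
  rw [hd] at henergy
  rw [← pitt_const_eq hβ, ENNReal.ofReal_mul (by positivity), hLam, mul_assoc]
  calc _ ≤ ∫⁻ x : EuclideanSpace ℝ (Fin n), ‖x‖ₑ ^ (-β) *
        ‖∫ ξ, Complex.exp (((-2 * π * ⟪x, ∑ k, ξ k⟫_ℝ : ℝ) : ℂ) * Complex.I) *
          fourierM (fun x => f x) ξ‖ₑ ^ 2 := by
        refine lintegral_mono_ae ?_
        filter_upwards [Measure.ae_ne volume 0] with x hx
        rw [← ENNReal.ofReal_rpow_of_pos (norm_pos_iff.2 hx), ofReal_norm, ← hdiag]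
        rfl
    _ ≤ _ := lintegral_enorm_rpow_mul_sq_le hFi (σ := fun ξ => ∑ k, ξ k) (by fun_prop)
        hFc.measurable hβ0
    _ ≤ _ := by
        gcongr
        exact henergy
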